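/- arXiv:1705.10558 — 3 statements merged into one kernel-verified Lean document; each statement's English description precedes it below -/
import Mathlib

section
/- Let u_K, u_L, u_{K*}, u_{L*} be strictly positive real numbers and let B_σ, B_{σ*} be nonnegative real numbers. Then B_σ·(√u_K − √u_L)² + B_{σ*}·(√u_{K*} − √u_{L*})² ≤ (1/4)·(u_K + u_L + u_{K*} + u_{L*})·( B_σ·(log u_K − log u_L)² + B_{σ*}·(log u_{K*} − log u_{L*})² ). -/
theorem sub_le_mul_log_sub_log {x y : ℝ} (hx : 0 < x) (hy : 0 < y) :
    x - y ≤ x * (Real.log x - Real.log y) := by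
  have h := Real.one_sub_inv_le_log_of_pos (div_pos hx hy)
  rw [Real.log_div hx.ne' hy.ne', inv_div] at h
  calc x - y = x * (1 - y / x) := by field_simp
    _ ≤ x * (Real.log x - Real.log y) := by gcongr

theorem sq_sub_le_mul_sq_log_sub_log {x y : ℝ} (hx : 0 < x) (hy : 0 < y) :
    (x - y) ^ 2 ≤ (x ^ 2 + y ^ 2) * (Real.log x - Real.log y) ^ 2 := by
  wlog hyx : y ≤ x generalizing x y
  · linarith [this hy hx (le_of_not_ge hyx)]
  have h := pow_le_pow_left₀ (sub_nonneg.2 hyx) (sub_le_mul_log_sub_log hx hy) 2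
  nlinarith [sq_nonneg (y * (Real.log x - Real.log y))]

theorem sq_sqrt_sub_sqrt_le {a b : ℝ} (ha : 0 < a) (hb : 0 < b) :
    (Real.sqrt a - Real.sqrt b) ^ 2 ≤ (1 / 4) * (a + b) * (Real.log a - Real.log b) ^ 2 := by
  have h := sq_sub_le_mul_sq_log_sub_log (Real.sqrt_pos.2 ha) (Real.sqrt_pos.2 hb)
  rw [Real.sq_sqrt ha.le, Real.sq_sqrt hb.le, Real.log_sqrt ha.le, Real.log_sqrt hb.le] at h
  linarith


/-- Per-diamond inequality (eq. (Fisher-01)): for positive `uK, uL, uKs, uLs` and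
nonnegative weights `Bσ, Bσs`,
`Bσ (√uK − √uL)² + Bσs (√uKs − √uLs)² ≤ ¼ (uK+uL+uKs+uLs) (Bσ (log uK − log uL)² + Bσs (log uKs − log uLs)²)`. -/
theorem stmt_0 (uK uL uKs uLs Bσ Bσs : ℝ)
    (huK : 0 < uK) (huL : 0 < uL) (huKs : 0 < uKs) (huLs : 0 < uLs)
    (hBσ : 0 ≤ Bσ) (hBσs : 0 ≤ Bσs) :
    Bσ * (Real.sqrt uK - Real.sqrt uL) ^ 2 + Bσs * (Real.sqrt uKs - Real.sqrt uLs) ^ 2 ≤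
      (1 / 4) * (uK + uL + uKs + uLs) *
        (Bσ * (Real.log uK - Real.log uL) ^ 2 + Bσs * (Real.log uKs - Real.log uLs) ^ 2) := by
  rw [mul_add, mul_left_comm _ Bσ, mul_left_comm _ Bσs]
  gcongr
  · refine (sq_sqrt_sub_sqrt_le huK huL).trans ?_
    gcongr ?_ * _
    linarith
  · refine (sq_sqrt_sub_sqrt_le huKs huLs).trans ?_
    gcongr ?_ * _
    linarith
end

section
/- Let A = [[a, c], [c, b]] be a real symmetric positive definite 2×2 matrix with eigenvalues 0 < λ_min ≤ λ_max, and let B = diag(|a| + |c|, |b| + |c|). Then for every w ∈ ℝ², wᵀBw ≤ √2 · (λ_max/λ_min) · wᵀAw. -/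
open Matrix

/-- The diagonal entries of a symmetric 2×2 matrix lie between its eigenvalues. -/
theorem mem_Icc_of_add_eq_of_mul_eq {p q r l L : ℝ} (hle : l ≤ L)
    (htr : p + q = l + L) (hdet : p * q - r ^ 2 = l * L) : p ∈ Set.Icc l L := by
  have hr : (p - l) * (p - L) = -r ^ 2 := by linear_combination p * htr - hdet
  constructor
  · by_contra! h
    nlinarith [mul_pos (sub_pos.2 h) (sub_pos.2 (h.trans_le hle))]
  · by_contra! h
    nlinarith [mul_pos (sub_pos.2 h) (sub_pos.2 (hle.trans_lt h))]

/-- The absolute row sum of a symmetric positive definite 2×2 matrix is at most `√2` times its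
largest eigenvalue. -/
theorem abs_add_abs_le_sqrt_two_mul {p q r l L : ℝ} (hl : 0 < l) (hle : l ≤ L)
    (htr : p + q = l + L) (hdet : p * q - r ^ 2 = l * L) : |p| + |r| ≤ Real.sqrt 2 * L := by
  obtain ⟨-, hpL⟩ := mem_Icc_of_add_eq_of_mul_eq hle htr hdet
  have hL : 0 ≤ L := hl.le.trans hle
  have hrow : p ^ 2 + r ^ 2 ≤ L ^ 2 := by
    have hq : q = l + L - p := by linarith
    subst hq
    nlinarith [mul_nonneg (sub_nonneg.2 hpL) (add_nonneg hl.le hL)]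
  refine abs_le_of_sq_le_sq' ?_ (by positivity) |>.2
  rw [mul_pow, Real.sq_sqrt (by norm_num)]
  nlinarith [sq_nonneg (|p| - |r|), sq_abs p, sq_abs r]

/-- The quadratic form of a symmetric 2×2 matrix is bounded below by its smallest eigenvalue. -/
theorem mul_sq_add_sq_le_quadraticForm {p q r l L : ℝ} (hle : l ≤ L)
    (htr : p + q = l + L) (hdet : p * q - r ^ 2 = l * L) (x y : ℝ) :
    l * (x ^ 2 + y ^ 2) ≤ p * x ^ 2 + 2 * r * x * y + q * y ^ 2 := by
  have hp := (mem_Icc_of_add_eq_of_mul_eq hle htr hdet).1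
  have hr : r ^ 2 = (p - l) * (q - l) := by linear_combination -hdet + l * htr
  rcases hp.eq_or_lt with h | h
  · have hr0 : r = 0 := by simpa [h] using hr
    have hq : q = L := by linarith
    subst hr0 hq h
    nlinarith [mul_nonneg (sub_nonneg.2 hle) (sq_nonneg y)]
  · refine sub_nonneg.1 ((mul_nonneg_iff_of_pos_left (sub_pos.2 h)).1 ?_)
    have : (p - l) * (p * x ^ 2 + 2 * r * x * y + q * y ^ 2 - l * (x ^ 2 + y ^ 2)) =
        ((p - l) * x + r * y) ^ 2 := by linear_combination -y ^ 2 * hr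
    rw [this]
    positivity

/-- If `A = [[a, c], [c, b]]` is a real symmetric positive definite 2×2 matrix
with eigenvalues `0 < λmin ≤ λmax` and `B = diag(|a| + |c|, |b| + |c|)`, then
`wᵀBw ≤ √2 · (λmax / λmin) · wᵀAw` for every `w ∈ ℝ²`. -/
theorem stmt_6 (a b c : ℝ) (A B : Matrix (Fin 2) (Fin 2) ℝ)
    (hA : A = !![a, c; c, b])
    (hHerm : A.IsHermitian) (hPD : A.PosDef)
    (lmin lmax : ℝ)
    (hlmin : lmin = min (hHerm.eigenvalues 0) (hHerm.eigenvalues 1))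
    (hlmax : lmax = max (hHerm.eigenvalues 0) (hHerm.eigenvalues 1))
    (hpos : 0 < lmin)
    (hB : B = !![|a| + |c|, 0; 0, |b| + |c|]) :
    ∀ w : Fin 2 → ℝ,
      w ⬝ᵥ B.mulVec w ≤ Real.sqrt 2 * (lmax / lmin) * (w ⬝ᵥ A.mulVec w) := by
  intro w
  have hle : lmin ≤ lmax := by rw [hlmin, hlmax]; exact min_le_max
  have htr : a + b = lmin + lmax := by
    have h := hHerm.trace_eq_sum_eigenvalues
    rw [hlmin, hlmax, min_add_max]
    simpa [hA, Matrix.trace_fin_two, Fin.sum_univ_two] using h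
  have hdet : a * b - c ^ 2 = lmin * lmax := by
    have h := hHerm.det_eq_prod_eigenvalues
    rw [Fin.prod_univ_two] at h
    rw [hlmin, hlmax, min_mul_max, sq, ← Matrix.det_fin_two_of, ← hA]
    simpa using h
  have ha := abs_add_abs_le_sqrt_two_mul hpos hle htr hdet
  have hb := abs_add_abs_le_sqrt_two_mul (p := b) (q := a) (r := c) hpos hle
    (by linarith) (by linarith)
  have hlmax0 : 0 ≤ lmax := hpos.le.trans hle
  have hwB : w ⬝ᵥ B.mulVec w = (|a| + |c|) * w 0 ^ 2 + (|b| + |c|) * w 1 ^ 2 := by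
    simp [hB, dotProduct, Matrix.mulVec, Fin.sum_univ_two]
    ring
  have hwA : w ⬝ᵥ A.mulVec w = a * w 0 ^ 2 + 2 * c * w 0 * w 1 + b * w 1 ^ 2 := by
    simp [hA, dotProduct, Matrix.mulVec, Fin.sum_univ_two]
    ring
  rw [hwB, hwA]
  calc (|a| + |c|) * w 0 ^ 2 + (|b| + |c|) * w 1 ^ 2
      ≤ Real.sqrt 2 * lmax * w 0 ^ 2 + Real.sqrt 2 * lmax * w 1 ^ 2 := by gcongr
    _ = Real.sqrt 2 * (lmax / lmin) * (lmin * (w 0 ^ 2 + w 1 ^ 2)) := by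
        field_simp
    _ ≤ _ := by
        gcongr
        exact mul_sq_add_sq_le_quadraticForm hle htr hdet _ _
end

section
/- Let Λ be a real symmetric positive definite 2×2 matrix, let n, m ∈ ℝ² be unit vectors with |⟨n, m⟩| < 1, and let s, t > 0. Set sinα := √(1 − ⟨n, m⟩²), θ := (s/t + t/s)/(2·sinα), κ := λ_max(Λ)/λ_min(Λ) (the ratio of the largest to the smallest eigenvalue of Λ), and define the 2×2 matrix A := (1/(2·s·t·sinα)) · [[s²·⟨Λn, n⟩, s·t·⟨Λn, m⟩], [s·t·⟨Λn, m⟩, t²·⟨Λm, m⟩]]. Then A is symmetric positive definite and its condition number satisfies λ_max(A)/λ_min(A) ≤ κ·(θ + √(θ² − 1/κ))². Moreover, if in addition λ_m·‖v‖² ≤ vᵀΛv ≤ λ^M·‖v‖² for all v ∈ ℝ² with 0 < λ_m ≤ λ^M, and θ ≤ θ★ for some θ★ ≥ 1, then λ_max(A)/λ_min(A) < 4·(θ★)²·λ^M/λ_m. -/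
open Matrix

namespace Matrix.IsHermitian

variable {M : Matrix (Fin 2) (Fin 2) ℝ} (h : M.IsHermitian)

theorem max_add_min_eigenvalues_fin_two :
    max (h.eigenvalues 0) (h.eigenvalues 1) + min (h.eigenvalues 0) (h.eigenvalues 1) =
      M 0 0 + M 1 1 := by
  have := h.trace_eq_sum_eigenvalues
  simp only [trace_fin_two, Fin.sum_univ_two, RCLike.ofReal_real_eq_id, id] at this
  rw [max_add_min, this]

theorem max_mul_min_eigenvalues_fin_two :
    max (h.eigenvalues 0) (h.eigenvalues 1) * min (h.eigenvalues 0) (h.eigenvalues 1) =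
      M 0 0 * M 1 1 - M 0 1 * M 1 0 := by
  have := h.det_eq_prod_eigenvalues
  simp only [det_fin_two, Fin.prod_univ_two, RCLike.ofReal_real_eq_id, id] at this
  rw [max_mul_min, this]

theorem mulVec_dotProduct_le_max_eigenvalues_fin_two (v : Fin 2 → ℝ) :
    M.mulVec v ⬝ᵥ v ≤ max (h.eigenvalues 0) (h.eigenvalues 1) * (v ⬝ᵥ v) := by
  have hadd := h.max_add_min_eigenvalues_fin_two
  have hmul := h.max_mul_min_eigenvalues_fin_two
  have hle : min (h.eigenvalues 0) (h.eigenvalues 1) ≤ max (h.eigenvalues 0) (h.eigenvalues 1) :=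
    min_le_max
  have hsymm : M 1 0 = M 0 1 := by simpa using h.apply 0 1
  generalize max (h.eigenvalues 0) (h.eigenvalues 1) = L at *
  generalize min (h.eigenvalues 0) (h.eigenvalues 1) = l at *
  rw [hsymm] at hmul
  simp only [mulVec, dotProduct, Fin.sum_univ_two, hsymm]
  have hprod : (L - M 0 0) * (L - M 1 1) = M 0 1 ^ 2 := by linear_combination L * hadd - hmul
  have h0 : 0 ≤ L - M 0 0 := by nlinarith [sq_nonneg (M 0 1)]
  have h1 : 0 ≤ L - M 1 1 := by nlinarith [sq_nonneg (M 0 1)]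
  rcases h0.eq_or_lt with h0 | h0
  · have hb : M 0 1 = 0 := by
      rw [← h0] at hprod
      exact pow_eq_zero_iff two_ne_zero |>.1 (by linarith)
    rw [hb]
    nlinarith [mul_nonneg h1 (sq_nonneg (v 1))]
  · refine sub_nonneg.1 (nonneg_of_mul_nonneg_right ?_ h0)
    have : (L - M 0 0) * (L * (v 0 * v 0 + v 1 * v 1) -
        ((M 0 0 * v 0 + M 0 1 * v 1) * v 0 + (M 0 1 * v 0 + M 1 1 * v 1) * v 1)) =
        ((L - M 0 0) * v 0 - M 0 1 * v 1) ^ 2 := by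
      linear_combination v 1 ^ 2 * hprod
    rw [this]
    positivity

end Matrix.IsHermitian

/-- An eigenvalue lies between any lower and upper bounds of the quadratic form. -/
theorem Matrix.IsHermitian.eigenvalues_mem_Icc_of_mulVec_dotProduct {ι : Type*} [Fintype ι]
    [DecidableEq ι] {M : Matrix ι ι ℝ} (h : M.IsHermitian) {a b : ℝ}
    (hab : ∀ v : ι → ℝ, a * (v ⬝ᵥ v) ≤ M.mulVec v ⬝ᵥ v ∧ M.mulVec v ⬝ᵥ v ≤ b * (v ⬝ᵥ v)) (i : ι) :
    h.eigenvalues i ∈ Set.Icc a b := by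
  have hv := hab (h.eigenvectorBasis i)
  have hne : (h.eigenvectorBasis i : ι → ℝ) ≠ 0 := fun h0 =>
    h.eigenvectorBasis.orthonormal.ne_zero i (by ext j; exact congrFun h0 j)
  have hpos : 0 < (h.eigenvectorBasis i : ι → ℝ) ⬝ᵥ (h.eigenvectorBasis i : ι → ℝ) :=
    lt_of_le_of_ne (Finset.sum_nonneg fun j _ => mul_self_nonneg _)
      (Ne.symm (mt dotProduct_self_eq_zero.1 hne))
  rw [h.mulVec_eigenvectorBasis, smul_dotProduct, smul_eq_mul] at hv
  exact ⟨le_of_mul_le_mul_right hv.1 hpos, le_of_mul_le_mul_right hv.2 hpos⟩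

/-- Two positive numbers with product `L * l / 4` and sum at most `L * θ` have ratio at most
`(L / l) * (θ + √(θ² - l / L))²`. -/
theorem div_le_of_mul_eq_of_add_le {L l θ x y : ℝ} (hL : 0 < L) (hl : 0 < l) (hx : 0 < x)
    (hy : 0 < y) (hmul : x * y = L * l / 4) (hadd : x + y ≤ L * θ) :
    x / y ≤ L / l * (θ + √(θ ^ 2 - 1 / (L / l))) ^ 2 := by
  have hsq : (2 * x / L - θ) ^ 2 ≤ θ ^ 2 - 1 / (L / l) := by
    have : θ ^ 2 - 1 / (L / l) - (2 * x / L - θ) ^ 2 = 4 * x * (L * θ - (x + y)) / L ^ 2 := by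
      field_simp
      linear_combination 4 * hmul
    have : 0 ≤ 4 * x * (L * θ - (x + y)) / L ^ 2 :=
      div_nonneg (mul_nonneg (by positivity) (by linarith)) (by positivity)
    linarith
  have hle : 2 * x / L ≤ θ + √(θ ^ 2 - 1 / (L / l)) := by
    linarith [Real.le_sqrt_of_sq_le hsq]
  calc x / y = L / l * (2 * x / L) ^ 2 := by
        field_simp
        linear_combination -4 * hmul
    _ ≤ _ := by gcongr

/-- Condition number bound (eq:condAD) for the local DDFV matrix `𝔸^𝒟`.
Given a symmetric positive definite `Λ`, unit vectors `n, m` with `|⟨n,m⟩| < 1`,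
lengths `s, t > 0`, and setting `sinα = √(1 − ⟨n,m⟩²)`, `θ = (s/t + t/s)/(2 sinα)`,
`κ = λmax(Λ)/λmin(Λ)`, the matrix
`A = (1/(2 s t sinα)) [[s²⟨Λn,n⟩, st⟨Λn,m⟩], [st⟨Λn,m⟩, t²⟨Λm,m⟩]]`
is symmetric positive definite with `Cond₂(A) ≤ κ (θ + √(θ² − 1/κ))²`; moreover if
`λ_m ‖v‖² ≤ vᵀΛv ≤ λ^M ‖v‖²` with `0 < λ_m ≤ λ^M` and `θ ≤ θ★` with `θ★ ≥ 1`,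
then `Cond₂(A) < 4 θ★² λ^M / λ_m`. -/
theorem stmt_7 (Λ : Matrix (Fin 2) (Fin 2) ℝ) (hΛH : Λ.IsHermitian) (hΛPD : Λ.PosDef)
    (n m : Fin 2 → ℝ) (hn : n ⬝ᵥ n = 1) (hm : m ⬝ᵥ m = 1) (hnm : |n ⬝ᵥ m| < 1)
    (s t : ℝ) (hs : 0 < s) (ht : 0 < t)
    (sinα θ κ : ℝ)
    (hsin : sinα = Real.sqrt (1 - (n ⬝ᵥ m) ^ 2))
    (hθ : θ = (s / t + t / s) / (2 * sinα))
    (hκ : κ = max (hΛH.eigenvalues 0) (hΛH.eigenvalues 1)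
        / min (hΛH.eigenvalues 0) (hΛH.eigenvalues 1))
    (A : Matrix (Fin 2) (Fin 2) ℝ)
    (hA : A = (1 / (2 * s * t * sinα)) •
      !![s ^ 2 * (Λ.mulVec n ⬝ᵥ n), s * t * (Λ.mulVec n ⬝ᵥ m);
         s * t * (Λ.mulVec n ⬝ᵥ m), t ^ 2 * (Λ.mulVec m ⬝ᵥ m)]) :
    A.PosDef ∧
    ∀ (hAH : A.IsHermitian),
      max (hAH.eigenvalues 0) (hAH.eigenvalues 1)
          / min (hAH.eigenvalues 0) (hAH.eigenvalues 1)
        ≤ κ * (θ + Real.sqrt (θ ^ 2 - 1 / κ)) ^ 2 ∧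
      ∀ (lm lM θstar : ℝ),
        (∀ v : Fin 2 → ℝ, lm * (v ⬝ᵥ v) ≤ Λ.mulVec v ⬝ᵥ v ∧ Λ.mulVec v ⬝ᵥ v ≤ lM * (v ⬝ᵥ v)) →
        0 < lm → lm ≤ lM → 1 ≤ θstar → θ ≤ θstar →
        max (hAH.eigenvalues 0) (hAH.eigenvalues 1)
            / min (hAH.eigenvalues 0) (hAH.eigenvalues 1)
          < 4 * θstar ^ 2 * lM / lm := by
  have hc : 0 < 1 - (n ⬝ᵥ m) ^ 2 := by
    have := (sq_lt_one_iff_abs_lt_one (n ⬝ᵥ m)).2 hnm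
    linarith
  have hsin0 : 0 < sinα := hsin ▸ Real.sqrt_pos.2 hc
  have hsin2 : sinα ^ 2 = 1 - (n ⬝ᵥ m) ^ 2 := by rw [hsin, Real.sq_sqrt hc.le]
  have hθ0 : 0 < θ := by rw [hθ]; positivity
  have hsymm : Λ 1 0 = Λ 0 1 := by simpa using hΛH.apply 0 1
  have hAB : A = (1 / (2 * s * t * sinα)) • (star !![s * n 0, t * m 0; s * n 1, t * m 1] * Λ *
      !![s * n 0, t * m 0; s * n 1, t * m 1]) := by
    rw [hA]
    congr 1
    ext i j
    fin_cases i <;> fin_cases j <;>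
      simp [Matrix.mul_apply, mulVec, dotProduct, Fin.sum_univ_two, star_apply, hsymm] <;> ring
  have hdetB : (!![s * n 0, t * m 0; s * n 1, t * m 1]).det ^ 2 = (s * t * sinα) ^ 2 := by
    rw [mul_pow _ sinα, hsin2, det_fin_two_of]
    simp only [dotProduct, Fin.sum_univ_two] at hn hm ⊢
    linear_combination s ^ 2 * t ^ 2 * (m 0 * m 0 + m 1 * m 1) * hn + s ^ 2 * t ^ 2 * hm
  have hdet : A.det = Λ.det / 4 := by
    rw [hAB, det_smul, det_mul, det_mul, star_eq_conjTranspose, det_conjTranspose, star_trivial,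
      Fintype.card_fin]
    have : (1 / (2 * s * t * sinα)) ^ 2 * (s * t * sinα) ^ 2 = 1 / 4 := by
      field_simp
      norm_num
    linear_combination (1 / (2 * s * t * sinα)) ^ 2 * Λ.det * hdetB + Λ.det * this
  have hAPD : A.PosDef := by
    have hB : IsUnit !![s * n 0, t * m 0; s * n 1, t * m 1] := by
      rw [isUnit_iff_isUnit_det, isUnit_iff_ne_zero]
      intro h0
      rw [h0] at hdetB
      have : 0 < (s * t * sinα) ^ 2 := by positivity
      linarith
    rw [hAB]
    exact (hB.posDef_star_left_conjugate_iff.2 hΛPD).smul (by positivity)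
  refine ⟨hAPD, fun hAH => ?_⟩
  have hl : 0 < min (hΛH.eigenvalues 0) (hΛH.eigenvalues 1) :=
    lt_min (hΛPD.eigenvalues_pos 0) (hΛPD.eigenvalues_pos 1)
  have hL : 0 < max (hΛH.eigenvalues 0) (hΛH.eigenvalues 1) := hl.trans_le min_le_max
  have hy : 0 < min (hAH.eigenvalues 0) (hAH.eigenvalues 1) :=
    lt_min (hAPD.eigenvalues_pos 0) (hAPD.eigenvalues_pos 1)
  have hx : 0 < max (hAH.eigenvalues 0) (hAH.eigenvalues 1) := hy.trans_le min_le_max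
  have hbound : max (hAH.eigenvalues 0) (hAH.eigenvalues 1)
      / min (hAH.eigenvalues 0) (hAH.eigenvalues 1) ≤ κ * (θ + √(θ ^ 2 - 1 / κ)) ^ 2 := by
    rw [hκ]
    refine div_le_of_mul_eq_of_add_le hL hl hx hy ?_ ?_
    · rw [hAH.max_mul_min_eigenvalues_fin_two, hΛH.max_mul_min_eigenvalues_fin_two,
        ← det_fin_two, ← det_fin_two, hdet]
    · rw [hAH.max_add_min_eigenvalues_fin_two]
      have hn' := hΛH.mulVec_dotProduct_le_max_eigenvalues_fin_two n
      have hm' := hΛH.mulVec_dotProduct_le_max_eigenvalues_fin_two m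
      rw [hn, mul_one] at hn'
      rw [hm, mul_one] at hm'
      generalize max (hΛH.eigenvalues 0) (hΛH.eigenvalues 1) = L at *
      calc A 0 0 + A 1 1
          = (1 / (2 * s * t * sinα)) *
              (s ^ 2 * (Λ.mulVec n ⬝ᵥ n) + t ^ 2 * (Λ.mulVec m ⬝ᵥ m)) := by
            rw [hA]; simp [mul_add]
        _ ≤ (1 / (2 * s * t * sinα)) * (s ^ 2 * L + t ^ 2 * L) := by gcongr
        _ = L * θ := by
            rw [hθ]
            field_simp
  refine ⟨hbound, fun lm lM θstar hΛ hlm _ _ hθs => hbound.trans_lt ?_⟩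
  have hκ0 : 0 < κ := by rw [hκ]; positivity
  have hκle : κ ≤ lM / lm := by
    have h0 := hΛH.eigenvalues_mem_Icc_of_mulVec_dotProduct hΛ 0
    have h1 := hΛH.eigenvalues_mem_Icc_of_mulVec_dotProduct hΛ 1
    rw [hκ]
    exact div_le_div₀ (hlm.le.trans (h0.1.trans h0.2)) (max_le h0.2 h1.2) hlm (le_min h0.1 h1.1)
  have hsqrt : √(θ ^ 2 - 1 / κ) < θ := by
    rw [Real.sqrt_lt' hθ0]
    linarith [one_div_pos.2 hκ0]
  calc κ * (θ + √(θ ^ 2 - 1 / κ)) ^ 2 < κ * (θ + θ) ^ 2 := by gcongr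
    _ ≤ lM / lm * (θstar + θstar) ^ 2 := by
        have := hκ0.le.trans hκle
        gcongr
    _ = 4 * θstar ^ 2 * lM / lm := by ring
end
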